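/- Let n ≥ 1, let S_1, …, S_m be subsets of {1, …, n} with S_1 ∪ ⋯ ∪ S_m = {1, …, n}, and in ℝ² define B_j = [2(j−1), 2(j−1)+1] × [0, 1], D = {(x, 1/2) : 0 ≤ x ≤ 2n − 1}, and A_i = D ∪ ⋃_{j ∈ S_i} B_j. Then for every subset T ⊆ {1, …, m}, the two-dimensional Lebesgue measure of ⋃_{i ∈ T} A_i equals n if and only if ⋃_{i ∈ T} S_i = {1, …, n}. -/

import Mathlib

open MeasureTheory

/-- The unit square `B_j` with bottom-left corner `(2 j, 0)` (using 0-based indexing). -/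
def unitSquare (j : ℕ) : Set (ℝ × ℝ) :=
  Set.Icc (2 * (j : ℝ)) (2 * (j : ℝ) + 1) ×ˢ Set.Icc (0 : ℝ) 1

/-- The horizontal segment `D` from `(0, 1/2)` to `(2n - 1, 1/2)`. -/
def midSegment (n : ℕ) : Set (ℝ × ℝ) :=
  Set.Icc (0 : ℝ) (2 * (n : ℝ) - 1) ×ˢ {(1 / 2 : ℝ)}

/-- The region `A_i = D ∪ ⋃_{j ∈ S_i} B_j` associated with the set `S_i`. -/
def coverRegion {n m : ℕ} (S : Fin m → Set (Fin n)) (i : Fin m) : Set (ℝ × ℝ) :=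
  midSegment n ∪ ⋃ j ∈ S i, unitSquare (j : ℕ)

theorem volume_unitSquare (j : ℕ) : volume (unitSquare j) = 1 := by
  rw [unitSquare, Measure.volume_eq_prod, Measure.prod_prod]
  simp

theorem volume_midSegment (n : ℕ) : volume (midSegment n) = 0 := by
  simp [midSegment, Measure.volume_eq_prod, Measure.prod_prod]

theorem measurableSet_unitSquare (j : ℕ) : MeasurableSet (unitSquare j) :=
  measurableSet_Icc.prod measurableSet_Icc

theorem disjoint_unitSquare_of_lt {i j : ℕ} (h : i < j) :
    Disjoint (unitSquare i) (unitSquare j) := by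
  refine Set.disjoint_left.2 fun x hi hj => ?_
  have hij : (i : ℝ) + 1 ≤ j := by exact_mod_cast h
  have hle : x.1 ≤ 2 * (i : ℝ) + 1 := hi.1.2
  have hge : 2 * (j : ℝ) ≤ x.1 := hj.1.1
  linarith

theorem pairwise_disjoint_unitSquare : Pairwise (Function.onFun Disjoint unitSquare) :=
  (pairwise_disjoint_on unitSquare).2 fun _ _ h => disjoint_unitSquare_of_lt h

/-- The area of a union of unit squares is the number of squares. -/
theorem volume_biUnion_unitSquare {n : ℕ} (U : Finset (Fin n)) :
    volume (⋃ j ∈ U, unitSquare (j : ℕ)) = (U.card : ENNReal) := by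
  rw [measure_biUnion_finset (f := fun j : Fin n => unitSquare (j : ℕ))
    (fun i _ j _ hij => pairwise_disjoint_unitSquare (Fin.val_injective.ne hij))
    (fun j _ => measurableSet_unitSquare j)]
  simp [volume_unitSquare]

/-- The mid-segment is negligible, so only the unit squares contribute to the area. -/
theorem volume_biUnion_coverRegion {n m : ℕ} (S : Fin m → Set (Fin n)) (T : Set (Fin m)) :
    volume (⋃ i ∈ T, coverRegion S i) = volume (⋃ j ∈ ⋃ i ∈ T, S i, unitSquare (j : ℕ)) := by
  apply le_antisymm
  · calc volume (⋃ i ∈ T, coverRegion S i)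
        ≤ volume (midSegment n ∪ ⋃ j ∈ ⋃ i ∈ T, S i, unitSquare (j : ℕ)) := by
          refine measure_mono (Set.iUnion₂_subset fun i hi => ?_)
          exact Set.union_subset_union_right _
            (Set.biUnion_subset_biUnion_left (Set.subset_biUnion_of_mem hi))
      _ ≤ volume (midSegment n) + volume (⋃ j ∈ ⋃ i ∈ T, S i, unitSquare (j : ℕ)) :=
          measure_union_le _ _
      _ = volume (⋃ j ∈ ⋃ i ∈ T, S i, unitSquare (j : ℕ)) := by
          rw [volume_midSegment, zero_add]
  · refine measure_mono (Set.iUnion₂_subset fun j hj => ?_)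
    obtain ⟨i, hi, hij⟩ := Set.mem_iUnion₂.1 hj
    intro x hx
    exact Set.mem_iUnion₂.2 ⟨i, hi, Or.inr (Set.mem_iUnion₂.2 ⟨j, hij, hx⟩)⟩

theorem volume_union_coverRegions_eq_n_iff_cover
    {n m : ℕ} (hn : 1 ≤ n) (S : Fin m → Set (Fin n))
    (hcover : ⋃ i, S i = Set.univ) (T : Set (Fin m)) :
    volume (⋃ i ∈ T, coverRegion S i) = (n : ENNReal) ↔
      ⋃ i ∈ T, S i = Set.univ := by
  classical
  rw [volume_biUnion_coverRegion]
  generalize ⋃ i ∈ T, S i = U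
  have hU := volume_biUnion_unitSquare U.toFinset
  simp only [Set.mem_toFinset] at hU
  rw [hU, Nat.cast_inj, ← Set.toFinset_eq_univ, ← Finset.card_eq_iff_eq_univ, Fintype.card_fin]
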